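/- Let (Q,P) be a weakly quasi-lattice ordered group and let Λ be a P-graph with FA(Λ) ≠ ∅. Then (PS(Λ),P,T) is a semigroup action: T(x,m) = x·m lies in PS(Λ) for every (x,m) ∈ PS(Λ)*P; (S1) for all x ∈ PS(Λ), (x,e) ∈ PS(Λ)*P and x·e = x; and (S2) for all x ∈ PS(Λ) and m,n ∈ P, (x,mn) ∈ PS(Λ)*P if and only if (x,m) ∈ PS(Λ)*P and (x·m,n) ∈ PS(Λ)*P, in which case (x·m)·n = x·(mn). -/

import Mathlib

set_option autoImplicit false

/-- The topology on the power set `Set α` obtained by identifying it with the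
product `∏ _ : α, Prop` where each (two-point) factor `Prop` carries the
discrete topology. -/
instance powersetTopology (α : Type) : TopologicalSpace (Set α) :=
  @Pi.topologicalSpace α (fun _ => Prop) (fun _ => ⊥)

/-- The cylinder `Z(K₁;K₂) = {x : K₁ ⊆ x ⊆ K₂ᶜ}`. -/
def cylinder {α : Type} (K₁ K₂ : Set α) : Set (Set α) :=
  {x | K₁ ⊆ x ∧ x ⊆ K₂ᶜ}

/-- The relation `p ≤ r` iff `p * q = r` for some `q ∈ P`. -/
def Submonoid.leftLE {Q : Type} [Group Q] (P : Submonoid Q) (p r : Q) : Prop :=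
  ∃ q ∈ P, p * q = r

/-- A weakly quasi-lattice ordered group `(Q,P)`: a group `Q` together with a
subsemigroup `P` containing the unit with `P ∩ P⁻¹ = {e}`, such that any two
elements of `P` with a common upper bound (for `leftLE`) have a least common
upper bound. -/
structure WQLO (Q : Type) [Group Q] where
  P : Submonoid Q
  inter_inv : ∀ p ∈ P, p⁻¹ ∈ P → p = 1
  lub : ∀ a ∈ P, ∀ b ∈ P, (∃ c ∈ P, P.leftLE a c ∧ P.leftLE b c) →
    ∃ l ∈ P, P.leftLE a l ∧ P.leftLE b l ∧
      ∀ c ∈ P, P.leftLE a c → P.leftLE b c → P.leftLE l c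

/-- A (discrete) `P`-graph: a countable small category, presented by its set of
morphisms `Λ` with range map `r`, source map `s` and a composition `mul`
(constrained by the axioms only on composable pairs, i.e. when `s μ = r ν`),
together with a degree functor `d : Λ → P` satisfying the unique factorisation
property. The units of `Λ` are exactly the elements of the form `r lam`. -/
structure PGraph (Q : Type) [Group Q] (W : WQLO Q) where
  Λ : Type
  countable : Countable Λ
  r : Λ → Λ
  s : Λ → Λ
  mul : Λ → Λ → Λ
  d : Λ → Q
  d_mem : ∀ lam, d lam ∈ W.P
  s_r : ∀ lam, s (r lam) = r lam
  r_r : ∀ lam, r (r lam) = r lam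
  s_s : ∀ lam, s (s lam) = s lam
  r_s : ∀ lam, r (s lam) = s lam
  id_mul : ∀ lam, mul (r lam) lam = lam
  mul_id : ∀ lam, mul lam (s lam) = lam
  r_mul : ∀ mu nu, s mu = r nu → r (mul mu nu) = r mu
  s_mul : ∀ mu nu, s mu = r nu → s (mul mu nu) = s nu
  mul_assoc : ∀ mu nu k, s mu = r nu → s nu = r k →
    mul (mul mu nu) k = mul mu (mul nu k)
  d_unit : ∀ lam, d (r lam) = 1
  d_mul : ∀ mu nu, s mu = r nu → d (mul mu nu) = d mu * d nu
  factor : ∀ lam, ∀ p ∈ W.P, ∀ q ∈ W.P, d lam = p * q →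
    ∃! mn : Λ × Λ, s mn.1 = r mn.2 ∧ mul mn.1 mn.2 = lam ∧ d mn.1 = p ∧ d mn.2 = q

namespace PGraph

variable {Q : Type} [Group Q] {W : WQLO Q} (G : PGraph Q W)

/-- `λΛ = {λμ : μ ∈ Λ, s λ = r μ}`. -/
def cone (lam : G.Λ) : Set G.Λ :=
  {x | ∃ mu, G.s lam = G.r mu ∧ x = G.mul lam mu}

/-- `λE = {λμ : μ ∈ E, s λ = r μ}`. -/
def coneSet (lam : G.Λ) (E : Set G.Λ) : Set G.Λ :=
  {x | ∃ mu ∈ E, G.s lam = G.r mu ∧ x = G.mul lam mu}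

/-- `Λ` is finitely aligned at the pair `(μ,ν)`. -/
def FinAlignedAtPair (mu nu : G.Λ) : Prop :=
  ∃ J : Finset G.Λ, G.cone mu ∩ G.cone nu = ⋃ lam ∈ (J : Set G.Λ), G.cone lam

/-- `Λ` is finitely aligned at `λ`. -/
def FinAlignedAt (lam : G.Λ) : Prop :=
  ∀ mu ∈ G.cone lam, ∀ nu : G.Λ, G.FinAlignedAtPair mu nu

/-- The finitely aligned part `FA(Λ)`. -/
def FA : Set G.Λ := {lam | G.FinAlignedAt lam}

/-- `FAr(Λ) = FA(Λ) ∪ r(FA(Λ))`. -/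
def FAr : Set G.Λ := G.FA ∪ G.r '' G.FA

/-- `μ ≼ λ` iff `μν = λ` for some `ν`. -/
def pre (mu lam : G.Λ) : Prop :=
  ∃ nu, G.s mu = G.r nu ∧ G.mul mu nu = lam

/-- A filter: a nonempty, hereditary and directed subset of `Λ`. -/
def IsFilter (x : Set G.Λ) : Prop :=
  x.Nonempty ∧ (∀ lam mu, G.pre lam mu → mu ∈ x → lam ∈ x) ∧
    ∀ mu ∈ x, ∀ nu ∈ x, ∃ lam ∈ x, G.pre mu lam ∧ G.pre nu lam

/-- The space `ℱΛ` of filters, with the subspace topology from `𝒫(Λ)`. -/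
abbrev FilterSpace := {x : Set G.Λ // G.IsFilter x}

/-- `Z_{ℱΛ}(μ;K) = {x ∈ ℱΛ : μ ∈ x ⊆ Λ∖K}`. -/
def Zf (mu : G.Λ) (K : Set G.Λ) : Set G.FilterSpace :=
  {x | mu ∈ x.1 ∧ x.1 ⊆ Kᶜ}

/-- An ultrafilter: a filter maximal with respect to inclusion. -/
def IsUltrafilter (x : Set G.Λ) : Prop :=
  G.IsFilter x ∧ ∀ y, G.IsFilter y → x ⊆ y → x = y

/-- The path space `PS(Λ)`: filters meeting `FA(Λ)` (as a set of subsets). -/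
def PS : Set (Set G.Λ) := {x | G.IsFilter x ∧ (x ∩ G.FA).Nonempty}

/-- The path space as a topological space (subspace of `𝒫(Λ)`). -/
abbrev PSpace := {x : Set G.Λ // x ∈ G.PS}

/-- The boundary-path space: the closure in `PS(Λ)` of the set of ultrafilters
lying in `PS(Λ)`. -/
def BPS : Set G.PSpace := closure {x : G.PSpace | G.IsUltrafilter x.1}

abbrev BPSpace := {x : G.PSpace // x ∈ G.BPS}

/-- The left shift `λ⁻¹·x = {μ : λμ ∈ x}`. -/
def lshift (lam : G.Λ) (x : Set G.Λ) : Set G.Λ :=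
  {mu | G.s lam = G.r mu ∧ G.mul lam mu ∈ x}

/-- The right shift `λ·x = {ζ : ζ ≼ λμ for some μ ∈ x}`. -/
def rshift (lam : G.Λ) (x : Set G.Λ) : Set G.Λ :=
  {z | ∃ mu ∈ x, G.s lam = G.r mu ∧ G.pre z (G.mul lam mu)}

/-- The action `x·m`: the left shift of `x` by the unique element of
`x ∩ Λ^m` (when it exists). -/
def act (x : Set G.Λ) (m : Q) : Set G.Λ :=
  ⋃ lam ∈ {l ∈ x | G.d l = m}, G.lshift lam x

/-- The domain `D_m = {x ∈ PS(Λ) : x ∩ Λ^m ≠ ∅}` of `T_m`. -/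
def Dom (m : Q) : Set (Set G.Λ) := {x ∈ G.PS | ∃ l ∈ x, G.d l = m}

/-- The range `R_m = {x·m : x ∈ D_m}` of `T_m`. -/
def Ran (m : Q) : Set (Set G.Λ) := {y | ∃ x ∈ G.Dom m, G.act x m = y}

end PGraph

namespace PGraph

variable {Q : Type} [Group Q] {W : WQLO Q} (G : PGraph Q W)

theorem eq_of_mul_eq_mul {a b a' b' : G.Λ} (h : G.s a = G.r b) (h' : G.s a' = G.r b')
    (hd : G.d a = G.d a') (hm : G.mul a b = G.mul a' b') : a = a' ∧ b = b' := by
  have hb : G.d b = G.d b' := by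
    have hdm := congrArg G.d hm
    rw [G.d_mul _ _ h, G.d_mul _ _ h', hd] at hdm
    exact mul_left_cancel hdm
  have hu := (G.factor (G.mul a b) (G.d a) (G.d_mem a) (G.d b) (G.d_mem b)
    (G.d_mul _ _ h)).unique (y₁ := (a, b)) (y₂ := (a', b')) ⟨h, rfl, rfl, rfl⟩
    ⟨h', hm.symm, hd.symm, hb.symm⟩
  exact Prod.ext_iff.mp hu

theorem mul_left_cancel {l a b : G.Λ} (ha : G.s l = G.r a) (hb : G.s l = G.r b)
    (h : G.mul l a = G.mul l b) : a = b :=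
  (G.eq_of_mul_eq_mul ha hb rfl h).2

variable {G}

theorem pre_mul {a b : G.Λ} (h : G.s a = G.r b) : G.pre a (G.mul a b) := ⟨b, h, rfl⟩

theorem mem_cone_iff {a b : G.Λ} : b ∈ G.cone a ↔ G.pre a b :=
  ⟨fun ⟨c, hc, e⟩ => ⟨c, hc, e.symm⟩, fun ⟨c, hc, e⟩ => ⟨c, hc, e.symm⟩⟩

theorem pre_refl (a : G.Λ) : G.pre a a := ⟨G.s a, (G.r_s a).symm, G.mul_id a⟩

theorem r_pre (a : G.Λ) : G.pre (G.r a) a := ⟨a, G.s_r a, G.id_mul a⟩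

theorem pre.r_eq {a b : G.Λ} (h : G.pre a b) : G.r a = G.r b := by
  obtain ⟨c, hc, rfl⟩ := h
  exact (G.r_mul _ _ hc).symm

theorem pre.trans {a b c : G.Λ} (hab : G.pre a b) (hbc : G.pre b c) : G.pre a c := by
  obtain ⟨u, hu, rfl⟩ := hab
  obtain ⟨v, hv, rfl⟩ := hbc
  rw [G.s_mul _ _ hu] at hv
  exact ⟨G.mul u v, by rw [G.r_mul _ _ hv, hu], (G.mul_assoc _ _ _ hu hv).symm⟩

/-- Composition on the left by `l` preserves and reflects the order. -/
theorem mul_pre_mul_iff {l a b : G.Λ} (ha : G.s l = G.r a) (hb : G.s l = G.r b) :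
    G.pre (G.mul l a) (G.mul l b) ↔ G.pre a b := by
  constructor
  · rintro ⟨u, hu, e⟩
    rw [G.s_mul _ _ ha] at hu
    rw [G.mul_assoc _ _ _ ha hu] at e
    exact ⟨u, hu, G.mul_left_cancel (by rw [G.r_mul _ _ hu, ha]) hb e⟩
  · rintro ⟨u, hu, rfl⟩
    exact ⟨u, by rw [G.s_mul _ _ ha, hu], G.mul_assoc _ _ _ ha hu⟩

/-- Finite alignment at `(a, b)` in terms of the order. -/
theorem finAlignedAtPair_iff {a b : G.Λ} : G.FinAlignedAtPair a b ↔
    ∃ J : Finset G.Λ, ∀ c, (G.pre a c ∧ G.pre b c) ↔ ∃ k ∈ J, G.pre k c := by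
  simp [FinAlignedAtPair, Set.ext_iff, mem_cone_iff]

theorem FinAlignedAtPair.of_mul {l a b : G.Λ} (ha : G.s l = G.r a) (hb : G.s l = G.r b)
    (h : G.FinAlignedAtPair (G.mul l a) (G.mul l b)) : G.FinAlignedAtPair a b := by
  classical
  rw [finAlignedAtPair_iff] at h ⊢
  obtain ⟨J, hJ⟩ := h
  have hlift : ∀ k ∈ J, ∃ k', G.s l = G.r k' ∧ G.mul l k' = k := fun k hk =>
    (pre_mul ha).trans ((hJ k).2 ⟨k, hk, pre_refl k⟩).1
  choose! f hf hfm using hlift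
  refine ⟨J.image f, fun c => ⟨fun hc => ?_, fun hc => ?_⟩⟩
  · have hlc : G.s l = G.r c := ha.trans hc.1.r_eq
    obtain ⟨k, hk, hkc⟩ := (hJ (G.mul l c)).1
      ⟨(mul_pre_mul_iff ha hlc).2 hc.1, (mul_pre_mul_iff hb hlc).2 hc.2⟩
    rw [← hfm k hk, mul_pre_mul_iff (hf k hk) hlc] at hkc
    exact ⟨f k, Finset.mem_image_of_mem f hk, hkc⟩
  · obtain ⟨k', hk', hkc⟩ := hc
    obtain ⟨k, hk, rfl⟩ := Finset.mem_image.1 hk'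
    have hlc : G.s l = G.r c := (hf k hk).trans hkc.r_eq
    have hJc := (hJ (G.mul l c)).2
      ⟨k, hk, by rw [← hfm k hk]; exact (mul_pre_mul_iff (hf k hk) hlc).2 hkc⟩
    exact ⟨(mul_pre_mul_iff ha hlc).1 hJc.1, (mul_pre_mul_iff hb hlc).1 hJc.2⟩

theorem mem_FA_of_pre {a b : G.Λ} (ha : a ∈ G.FA) (h : G.pre a b) : b ∈ G.FA :=
  fun c hc nu => ha c (mem_cone_iff.2 (h.trans (mem_cone_iff.1 hc))) nu

theorem mem_FA_of_mul_mem_FA {l a : G.Λ} (hla : G.s l = G.r a) (h : G.mul l a ∈ G.FA) :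
    a ∈ G.FA := by
  intro b hb nu
  rw [mem_cone_iff] at hb
  have hlb : G.s l = G.r b := hla.trans hb.r_eq
  by_cases hnu : G.s l = G.r nu
  · exact (h _ (mem_cone_iff.2 ((mul_pre_mul_iff hla hlb).2 hb)) _).of_mul hlb hnu
  · refine finAlignedAtPair_iff.2 ⟨∅, fun c => ⟨fun hc => ?_, by simp⟩⟩
    exact absurd (hlb.trans (hc.1.r_eq.trans hc.2.r_eq.symm)) hnu

/-- The degree map is injective on filters. -/
theorem IsFilter.injOn_d {x : Set G.Λ} (hx : G.IsFilter x) : Set.InjOn G.d x := by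
  intro a ha b hb hd
  obtain ⟨_, _, ⟨u, hu, rfl⟩, ⟨v, hv, e⟩⟩ := hx.2.2 a ha b hb
  exact (G.eq_of_mul_eq_mul hu hv hd e.symm).1

theorem IsFilter.act_d {x : Set G.Λ} (hx : G.IsFilter x) {l : G.Λ} (hl : l ∈ x) :
    G.act x (G.d l) = G.lshift l x := by
  have hsep : {k ∈ x | G.d k = G.d l} = {l} := by
    ext k
    exact ⟨fun hk => hx.injOn_d hk.1 hl hk.2, by rintro rfl; exact ⟨hl, rfl⟩⟩
  rw [act, hsep, Set.biUnion_singleton]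

theorem IsFilter.lshift {x : Set G.Λ} (hx : G.IsFilter x) {l : G.Λ} (hl : l ∈ x) :
    G.IsFilter (G.lshift l x) := by
  refine ⟨⟨G.s l, (G.r_s l).symm, by rwa [G.mul_id]⟩, ?_, ?_⟩
  · rintro a b hab ⟨hlb, hb⟩
    have hla : G.s l = G.r a := hlb.trans hab.r_eq.symm
    exact ⟨hla, hx.2.1 _ _ ((mul_pre_mul_iff hla hlb).2 hab) hb⟩
  · rintro a ⟨hla, ha⟩ b ⟨hlb, hb⟩
    obtain ⟨c, hc, hac, hbc⟩ := hx.2.2 _ ha _ hb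
    obtain ⟨c, hlc, rfl⟩ := (pre_mul hla).trans hac
    exact ⟨c, ⟨hlc, hc⟩, (mul_pre_mul_iff hla hlc).1 hac, (mul_pre_mul_iff hlb hlc).1 hbc⟩

theorem lshift_mem_PS {x : Set G.Λ} (hx : x ∈ G.PS) {l : G.Λ} (hl : l ∈ x) :
    G.lshift l x ∈ G.PS := by
  obtain ⟨hf, k, hk, hkFA⟩ := hx
  obtain ⟨_, hc, ⟨u, hu, rfl⟩, hkc⟩ := hf.2.2 l hl k hk
  exact ⟨hf.lshift hl, u, ⟨hu, hc⟩, mem_FA_of_mul_mem_FA hu (mem_FA_of_pre hkFA hkc)⟩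

theorem IsFilter.r_mem {x : Set G.Λ} (hx : G.IsFilter x) {l : G.Λ} (hl : l ∈ x) :
    G.r l ∈ x :=
  hx.2.1 _ _ (r_pre l) hl

theorem IsFilter.lshift_r {x : Set G.Λ} (hx : G.IsFilter x) {l : G.Λ} (hl : l ∈ x) :
    G.lshift (G.r l) x = x := by
  ext a
  constructor
  · rintro ⟨hla, ha⟩
    rwa [← G.s_r, hla, G.id_mul] at ha
  · intro ha
    have hr : G.r l = G.r a :=
      hx.injOn_d (hx.r_mem hl) (hx.r_mem ha) (by rw [G.d_unit, G.d_unit])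
    exact ⟨by rw [G.s_r, hr], by rwa [hr, G.id_mul]⟩

theorem lshift_lshift {a b : G.Λ} (h : G.s a = G.r b) (x : Set G.Λ) :
    G.lshift b (G.lshift a x) = G.lshift (G.mul a b) x := by
  ext c
  simp only [lshift, Set.mem_ofPred_eq, G.s_mul _ _ h]
  refine and_congr_right fun hbc => ?_
  rw [G.mul_assoc _ _ _ h hbc, G.r_mul _ _ hbc]
  exact and_iff_right h

end PGraph


/-- `(PS(Λ), P, T)` is a semigroup action: `x·m ∈ PS(Λ)` for
`(x,m) ∈ PS(Λ)*P`; (S1) `(x,e) ∈ PS(Λ)*P` and `x·e = x`; and (S2)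
`(x,mn) ∈ PS(Λ)*P` iff `(x,m) ∈ PS(Λ)*P` and `(x·m,n) ∈ PS(Λ)*P`, in which
case `(x·m)·n = x·(mn)`. -/
theorem statement12 {Q : Type} [Group Q] {W : WQLO Q} (G : PGraph Q W)
    (hne : G.FA.Nonempty) :
    (∀ x ∈ G.PS, ∀ m ∈ W.P, (∃ l ∈ x, G.d l = m) → G.act x m ∈ G.PS) ∧
    (∀ x ∈ G.PS, (∃ l ∈ x, G.d l = (1 : Q)) ∧ G.act x 1 = x) ∧
    (∀ x ∈ G.PS, ∀ m ∈ W.P, ∀ n ∈ W.P,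
      ((∃ l ∈ x, G.d l = m * n) ↔
        ((∃ l ∈ x, G.d l = m) ∧ G.act x m ∈ G.PS ∧ ∃ l' ∈ G.act x m, G.d l' = n)) ∧
      ((∃ l ∈ x, G.d l = m * n) → G.act (G.act x m) n = G.act x (m * n))) := by
  refine ⟨?_, ?_, ?_⟩
  · rintro x hx _ - ⟨l, hl, rfl⟩
    rw [hx.1.act_d hl]
    exact PGraph.lshift_mem_PS hx hl
  · intro x hx
    obtain ⟨l, hl⟩ := hx.1.1
    refine ⟨⟨G.r l, hx.1.r_mem hl, G.d_unit l⟩, ?_⟩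
    rw [← G.d_unit l, hx.1.act_d (hx.1.r_mem hl), hx.1.lshift_r hl]
  · intro x hx m hm n hn
    have hfactor : (∃ l ∈ x, G.d l = m * n) →
        ∃ a b, G.s a = G.r b ∧ a ∈ x ∧ G.mul a b ∈ x ∧ G.d a = m ∧ G.d b = n := by
      rintro ⟨l, hl, hd⟩
      obtain ⟨⟨a, b⟩, ⟨hab, rfl, ha, hb⟩, -⟩ := G.factor l m hm n hn hd
      exact ⟨a, b, hab, hx.1.2.1 _ _ (PGraph.pre_mul hab) hl, hl, ha, hb⟩
    refine ⟨⟨fun h => ?_, ?_⟩, fun h => ?_⟩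
    · obtain ⟨a, b, hab, ha, hmul, rfl, rfl⟩ := hfactor h
      rw [hx.1.act_d ha]
      exact ⟨⟨a, ha, rfl⟩, PGraph.lshift_mem_PS hx ha, b, ⟨hab, hmul⟩, rfl⟩
    · rintro ⟨⟨a, ha, rfl⟩, -, b, hb, rfl⟩
      rw [hx.1.act_d ha] at hb
      exact ⟨G.mul a b, hb.2, G.d_mul _ _ hb.1⟩
    · obtain ⟨a, b, hab, ha, hmul, rfl, rfl⟩ := hfactor h
      rw [hx.1.act_d ha, (hx.1.lshift ha).act_d ⟨hab, hmul⟩, ← G.d_mul _ _ hab,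
        hx.1.act_d hmul, PGraph.lshift_lshift hab]
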